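/- Let {X_n}_{n≥1} be a symmetric correlated random walk with delays on {1,0,-1} with parameters 0≤p,q,r<1, p+r≤1, 2p+r>0, started from the stationary distribution. Let A,B be positive integers, S_n = X_1+···+X_n, and τ = inf{k : S_k = A or S_k = -B}. Then E(τ) = A·B·(1+r-q)(2-2p-r)/((1-q)(2p+r)) + (A+B)·(2p+r-1)(1+r-q)/((1-q)(2p+r)) + (q-r)·r/((1-q)(1+r-q)). -/

import Mathlib

open MeasureTheory ProbabilityTheory Set

noncomputable section

variable {Ω : Type*} [MeasurableSpace Ω]

/-- The σ-algebra `σ(X_1, …, X_n)` generated by the first `n` steps of the process. -/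
def sigmaUpTo (X : ℕ → Ω → ℝ) (n : ℕ) : MeasurableSpace Ω :=
  ⨆ i ∈ Finset.Icc 1 n, MeasurableSpace.comap (X i) inferInstance

/-- The transition kernel of the symmetric correlated random walk with delays on
`{1, 0, -1}`: from state `1` the probabilities of `(1, 0, -1)` are `(p, r, 1-p-r)`;
from state `0` they are `((1-q)/2, q, (1-q)/2)`; from state `-1` they are
`(1-p-r, r, p)`. -/
def delayKernel (p q r : ℝ) (i j : ℝ) : ℝ :=
  if i = 1 then (if j = 1 then p else if j = 0 then r else 1 - p - r)
  else if i = 0 then (if j = 0 then q else (1 - q) / 2)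
  else (if j = 1 then 1 - p - r else if j = 0 then r else p)

/-- `X` is a symmetric correlated random walk with delays on `{1, 0, -1}` with
parameters `p, q, r`, started from the stationary distribution
`((1-q)/(2(1+r-q)), r/(1+r-q), (1-q)/(2(1+r-q)))`: each `X n` (for `n ≥ 1`) is
measurable with values in `{1, 0, -1}`, the initial distribution is stationary,
and the Markov property with the prescribed time-homogeneous transition
probabilities holds, conditionally on `F n = σ(X_1, …, X_n)`. -/
def IsDelayedCRW (μ : Measure Ω) (X : ℕ → Ω → ℝ) (p q r : ℝ) : Prop :=
  (∀ i, 1 ≤ i → Measurable (X i)) ∧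
  (∀ n, 1 ≤ n → ∀ ω, X n ω = 1 ∨ X n ω = 0 ∨ X n ω = -1) ∧
  (μ {ω | X 1 ω = 1} = ENNReal.ofReal ((1 - q) / (2 * (1 + r - q)))) ∧
  (μ {ω | X 1 ω = 0} = ENNReal.ofReal (r / (1 + r - q))) ∧
  (∀ n, 1 ≤ n → ∀ i ∈ ({1, 0, -1} : Set ℝ), ∀ j ∈ ({1, 0, -1} : Set ℝ),
    ∀ E : Set Ω, MeasurableSet[sigmaUpTo X n] E →
      μ (E ∩ {ω | X n ω = i ∧ X (n + 1) ω = j})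
        = ENNReal.ofReal (delayKernel p q r i j) * μ (E ∩ {ω | X n ω = i}))

/-- The position `X_1 + ⋯ + X_n` of the walk with steps `X_i`. -/
def walk (X : ℕ → Ω → ℝ) (n : ℕ) (ω : Ω) : ℝ := ∑ i ∈ Finset.Icc 1 n, X i ω

/-- The event that the walk visits neither `A` nor `-B` at the times `1, …, n`. -/
def noRuin (X : ℕ → Ω → ℝ) (A B : ℕ) (n : ℕ) : Set Ω :=
  {ω | ∀ k ∈ Finset.Icc 1 n, walk X k ω ≠ (A : ℝ) ∧ walk X k ω ≠ -(B : ℝ)}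

/-- One-step average of `f` under the transition kernel, from state `i`. -/
def delayAverage (p q r : ℝ) (f : ℝ → ℝ) (i : ℝ) : ℝ :=
  ∑ j ∈ ({1, 0, -1} : Finset ℝ), delayKernel p q r i j * f j

omit [MeasurableSpace Ω] in
lemma walk_succ (X : ℕ → Ω → ℝ) (n : ℕ) (ω : Ω) :
    walk X (n + 1) ω = walk X n ω + X (n + 1) ω :=
  Finset.sum_Icc_succ_top (by omega) _

omit [MeasurableSpace Ω] in
lemma walk_one (X : ℕ → Ω → ℝ) (ω : Ω) : walk X 1 ω = X 1 ω := by
  simp [walk]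

omit [MeasurableSpace Ω] in
lemma noRuin_zero (X : ℕ → Ω → ℝ) (A B : ℕ) : noRuin X A B 0 = univ := by
  simp [noRuin]

omit [MeasurableSpace Ω] in
lemma mem_noRuin_succ {X : ℕ → Ω → ℝ} {A B n : ℕ} {ω : Ω} :
    ω ∈ noRuin X A B (n + 1) ↔ ω ∈ noRuin X A B n ∧
      walk X (n + 1) ω ≠ (A : ℝ) ∧ walk X (n + 1) ω ≠ -(B : ℝ) := by
  constructor
  · intro h
    refine ⟨fun k hk => h k ?_, h _ (by simp)⟩
    simp only [Finset.mem_Icc] at hk ⊢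
    omega
  · rintro ⟨h, h'⟩ k hk
    simp only [Finset.mem_Icc] at hk
    rcases Nat.lt_or_ge n k with hlt | hle
    · obtain rfl : k = n + 1 := by omega
      exact h'
    · exact h k (by simp only [Finset.mem_Icc]; omega)

omit [MeasurableSpace Ω] in
lemma exists_int_step {X : ℕ → Ω → ℝ}
    (hval : ∀ n, 1 ≤ n → ∀ ω, X n ω = 1 ∨ X n ω = 0 ∨ X n ω = -1)
    {n : ℕ} (hn : 1 ≤ n) (ω : Ω) : ∃ x : ℤ, X n ω = x ∧ (x = 1 ∨ x = 0 ∨ x = -1) := by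
  rcases hval n hn ω with h | h | h
  · exact ⟨1, by simp [h], by simp⟩
  · exact ⟨0, by simp [h], by simp⟩
  · exact ⟨-1, by simp [h], by simp⟩

omit [MeasurableSpace Ω] in
/-- Before ruin the walk is at an integer strictly between the two barriers. -/
lemma exists_int_walk_of_mem_noRuin {X : ℕ → Ω → ℝ}
    (hval : ∀ n, 1 ≤ n → ∀ ω, X n ω = 1 ∨ X n ω = 0 ∨ X n ω = -1)
    {A B : ℕ} (hA : 0 < A) (hB : 0 < B) (n : ℕ) {ω : Ω} (h : ω ∈ noRuin X A B n) :
    ∃ z ∈ Finset.Ioo (-(B : ℤ)) A, walk X n ω = z := by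
  induction n with
  | zero => exact ⟨0, by simp [hA, hB], by simp [walk]⟩
  | succ n ih =>
    rw [mem_noRuin_succ] at h
    obtain ⟨z, hz, hwz⟩ := ih h.1
    obtain ⟨x, hx, hx'⟩ := exists_int_step hval (Nat.le_add_left 1 n) ω
    have hw : walk X (n + 1) ω = ((z + x : ℤ) : ℝ) := by
      rw [walk_succ, hwz, hx]; push_cast; rfl
    rw [hw] at h
    have h1 : z + x ≠ A := fun e => h.2.1 (by rw [e]; push_cast; rfl)
    have h2 : z + x ≠ -B := fun e => h.2.2 (by rw [e]; push_cast; rfl)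
    refine ⟨z + x, ?_, hw⟩
    simp only [Finset.mem_Ioo] at hz ⊢
    omega

omit [MeasurableSpace Ω] in
/-- At the moment of ruin the last step points towards the barrier that is hit. -/
lemma walk_step_of_ruin {X : ℕ → Ω → ℝ}
    (hval : ∀ n, 1 ≤ n → ∀ ω, X n ω = 1 ∨ X n ω = 0 ∨ X n ω = -1)
    {A B : ℕ} (hA : 0 < A) (hB : 0 < B) (n : ℕ) {ω : Ω} (h : ω ∈ noRuin X A B n)
    (h' : ω ∉ noRuin X A B (n + 1)) :
    (walk X (n + 1) ω = A ∧ X (n + 1) ω = 1) ∨ (walk X (n + 1) ω = -B ∧ X (n + 1) ω = -1) := by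
  obtain ⟨z, hz, hwz⟩ := exists_int_walk_of_mem_noRuin hval hA hB n h
  obtain ⟨x, hx, hx'⟩ := exists_int_step hval (Nat.le_add_left 1 n) ω
  have hw : walk X (n + 1) ω = ((z + x : ℤ) : ℝ) := by
    rw [walk_succ, hwz, hx]; push_cast; rfl
  rw [mem_noRuin_succ] at h'
  have h'' : walk X (n + 1) ω = (A : ℝ) ∨ walk X (n + 1) ω = -(B : ℝ) := by tauto
  simp only [Finset.mem_Ioo] at hz
  rcases h'' with e | e
  · refine Or.inl ⟨e, ?_⟩
    have e' : z + x = A := by rw [hw] at e; exact_mod_cast e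
    obtain rfl : x = 1 := by omega
    simpa using hx
  · refine Or.inr ⟨e, ?_⟩
    have e' : z + x = -B := by rw [hw] at e; exact_mod_cast e
    obtain rfl : x = -1 := by omega
    simpa using hx

lemma sigmaUpTo_le {X : ℕ → Ω → ℝ} (hX : ∀ i, 1 ≤ i → Measurable (X i)) (n : ℕ) :
    sigmaUpTo X n ≤ ‹MeasurableSpace Ω› :=
  iSup₂_le fun i hi => (hX i (Finset.mem_Icc.1 hi).1).comap_le

omit [MeasurableSpace Ω] in
lemma measurable_walk_sigmaUpTo (X : ℕ → Ω → ℝ) {k n : ℕ} (hkn : k ≤ n) :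
    Measurable[sigmaUpTo X n] (walk X k) := by
  refine Finset.measurable_fun_sum _ fun i hi => ?_
  have hi' : i ∈ Finset.Icc 1 n := by
    simp only [Finset.mem_Icc] at hi ⊢
    omega
  exact (comap_measurable (X i)).mono
    (le_iSup₂_of_le (f := fun i _ => MeasurableSpace.comap (X i) inferInstance) i hi' le_rfl) le_rfl

omit [MeasurableSpace Ω] in
lemma measurableSet_noRuin_sigmaUpTo (X : ℕ → Ω → ℝ) (A B n : ℕ) :
    MeasurableSet[sigmaUpTo X n] (noRuin X A B n) := by
  have : noRuin X A B n =
      ⋂ k ∈ Finset.Icc 1 n, walk X k ⁻¹' ({(A : ℝ)}ᶜ ∩ {-(B : ℝ)}ᶜ) := by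
    ext ω
    simp [noRuin]
  rw [this]
  refine Finset.measurableSet_biInter _ fun k hk => ?_
  exact measurable_walk_sigmaUpTo X (Finset.mem_Icc.1 hk).2
    ((measurableSet_singleton _).compl.inter (measurableSet_singleton _).compl)

/-- Integral over an event of a function of a random variable with finitely many values. -/
lemma setIntegral_comp_eq_sum {μ : Measure Ω} [IsFiniteMeasure μ] {Y : Ω → ℝ} (hY : Measurable Y)
    {s : Finset ℝ} (hs : ∀ ω, Y ω ∈ s) (E : Set Ω) (f : ℝ → ℝ) :
    ∫ ω in E, f (Y ω) ∂μ = ∑ j ∈ s, μ.real (E ∩ {ω | Y ω = j}) * f j := by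
  have hm : ∀ j, MeasurableSet {ω | Y ω = j} := fun j => hY (measurableSet_singleton j)
  have h : ∀ ω, f (Y ω) = ∑ j ∈ s, {ω | Y ω = j}.indicator (fun _ => f j) ω := by
    intro ω
    rw [Finset.sum_eq_single (Y ω)]
    · simp
    · intro j _ hj
      exact indicator_of_notMem (fun e => hj (Eq.symm e)) _
    · exact fun h => absurd (hs ω) h
  simp_rw [h]
  rw [integral_finsetSum _ fun j _ => (integrable_const _).indicator (hm j)]
  refine Finset.sum_congr rfl fun j _ => ?_
  rw [setIntegral_indicator (hm j), setIntegral_const, smul_eq_mul]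

lemma delayKernel_nonneg {p q r : ℝ} (hp0 : 0 ≤ p) (hq0 : 0 ≤ q) (hq1 : q < 1)
    (hr0 : 0 ≤ r) (hpr : p + r ≤ 1) (i j : ℝ) : 0 ≤ delayKernel p q r i j := by
  unfold delayKernel
  split_ifs <;> linarith

namespace IsDelayedCRW

variable {μ : Measure Ω} {X : ℕ → Ω → ℝ} {p q r : ℝ}

lemma mem_finset (hX : IsDelayedCRW μ X p q r) {n : ℕ} (hn : 1 ≤ n) (ω : Ω) :
    X n ω ∈ ({1, 0, -1} : Finset ℝ) := by
  simpa using hX.2.1 n hn ω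

/-- The Markov property, in integrated form. -/
lemma setIntegral_succ [IsFiniteMeasure μ] (hX : IsDelayedCRW μ X p q r)
    (hk : ∀ i j, 0 ≤ delayKernel p q r i j) {n : ℕ} (hn : 1 ≤ n) {E : Set Ω}
    (hE : MeasurableSet[sigmaUpTo X n] E) (f : ℝ → ℝ) :
    ∫ ω in E, f (X (n + 1) ω) ∂μ = ∫ ω in E, delayAverage p q r f (X n ω) ∂μ := by
  have hn' : 1 ≤ n + 1 := by omega
  have hsplit : ∀ j ∈ ({1, 0, -1} : Finset ℝ), μ.real (E ∩ {ω | X (n + 1) ω = j}) =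
      ∑ i ∈ ({1, 0, -1} : Finset ℝ), delayKernel p q r i j * μ.real (E ∩ {ω | X n ω = i}) := by
    intro j hj
    have h := setIntegral_comp_eq_sum (μ := μ) (hX.1 n hn) (hX.mem_finset hn)
      (E ∩ {ω | X (n + 1) ω = j}) (fun _ => 1)
    simp only [mul_one, setIntegral_const, smul_eq_mul] at h
    rw [h]
    refine Finset.sum_congr rfl fun i hi => ?_
    have h2 := hX.2.2.2.2 n hn i (by simpa using hi) j (by simpa using hj) E hE
    have h3 : E ∩ {ω | X (n + 1) ω = j} ∩ {ω | X n ω = i} =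
        E ∩ {ω | X n ω = i ∧ X (n + 1) ω = j} := by
      ext ω
      simp only [mem_inter_iff, mem_ofPred_eq]
      tauto
    rw [h3, measureReal_def, h2, ENNReal.toReal_mul, ENNReal.toReal_ofReal (hk i j),
      measureReal_def]
  rw [setIntegral_comp_eq_sum (hX.1 _ hn') (hX.mem_finset hn') E,
    setIntegral_comp_eq_sum (hX.1 n hn) (hX.mem_finset hn) E (delayAverage p q r f),
    Finset.sum_congr rfl fun j hj => by rw [hsplit j hj, Finset.sum_mul], Finset.sum_comm]
  refine Finset.sum_congr rfl fun i _ => ?_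
  rw [delayAverage, Finset.mul_sum]
  exact Finset.sum_congr rfl fun j _ => by ring

lemma measurableSet_noRuin (hX : IsDelayedCRW μ X p q r) (A B n : ℕ) :
    MeasurableSet (noRuin X A B n) :=
  sigmaUpTo_le hX.1 n _ (measurableSet_noRuin_sigmaUpTo X A B n)

lemma measurable_walk (hX : IsDelayedCRW μ X p q r) (n : ℕ) : Measurable (walk X n) :=
  (measurable_walk_sigmaUpTo X le_rfl).mono (sigmaUpTo_le hX.1 n) le_rfl

lemma abs_walk_le (hX : IsDelayedCRW μ X p q r) (n : ℕ) (ω : Ω) : |walk X n ω| ≤ n := by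
  refine (Finset.abs_sum_le_sum_abs _ _).trans ?_
  have h : ∀ i ∈ Finset.Icc 1 n, |X i ω| ≤ 1 := fun i hi => by
    rcases hX.2.1 i (Finset.mem_Icc.1 hi).1 ω with h | h | h <;> simp [h]
  simpa using Finset.sum_le_card_nsmul _ _ _ h

lemma abs_step_le (hX : IsDelayedCRW μ X p q r) {n : ℕ} (hn : 1 ≤ n) (ω : Ω) :
    |X n ω| ≤ 1 := by
  rcases hX.2.1 n hn ω with h | h | h <;> simp [h]

end IsDelayedCRW

lemma exists_abs_le_of_continuous {R : ℝ → ℝ → ℝ} (hR : Continuous fun x : ℝ × ℝ => R x.1 x.2)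
    (M : ℝ) : ∃ K, ∀ s x, |s| ≤ M → |x| ≤ 1 → |R s x| ≤ K := by
  have hcomp : IsCompact (Icc ((-M, -1) : ℝ × ℝ) (M, 1)) := isCompact_Icc
  obtain ⟨K, hK⟩ := hcomp.exists_bound_of_continuousOn hR.continuousOn
  refine ⟨K, fun s x hs hx => ?_⟩
  rw [abs_le] at hs hx
  exact hK (s, x) ⟨⟨hs.1, hx.1⟩, ⟨hs.2, hx.2⟩⟩

section Potential

variable {μ : Measure Ω} [IsProbabilityMeasure μ] {X : ℕ → Ω → ℝ} {p q r : ℝ}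
  {R : ℝ → ℝ → ℝ} {A B : ℕ} {c : ℝ}

lemma IsDelayedCRW.integrable_potential (hX : IsDelayedCRW μ X p q r)
    (hR : Continuous fun x : ℝ × ℝ => R x.1 x.2) {n : ℕ} (hn : 1 ≤ n) :
    Integrable (fun ω => R (walk X n ω) (X n ω)) μ := by
  obtain ⟨K, hK⟩ := exists_abs_le_of_continuous hR n
  refine Integrable.of_bound
    (hR.measurable.comp ((hX.measurable_walk n).prodMk (hX.1 n hn))).aestronglyMeasurable K ?_
  exact Filter.Eventually.of_forall fun ω => hK _ _ (hX.abs_walk_le n ω) (hX.abs_step_le hn ω)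

/-- Dynkin's formula for one step of the walk, on the event of no ruin up to time `n`. -/
lemma IsDelayedCRW.setIntegral_potential_step (hX : IsDelayedCRW μ X p q r)
    (hk : ∀ i j, 0 ≤ delayKernel p q r i j) (hA : 0 < A) (hB : 0 < B)
    (hR : Continuous fun x : ℝ × ℝ => R x.1 x.2)
    (hstep : ∀ s, ∀ i ∈ ({1, 0, -1} : Finset ℝ),
      delayAverage p q r (fun j => R (s + j) j) i = R s i + c)
    {n : ℕ} (hn : 1 ≤ n) :
    ∫ ω in noRuin X A B n, R (walk X (n + 1) ω) (X (n + 1) ω) ∂μ =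
      ∫ ω in noRuin X A B n, R (walk X n ω) (X n ω) ∂μ + c * μ.real (noRuin X A B n) := by
  set E : ℤ → Set Ω := fun z => noRuin X A B n ∩ {ω | walk X n ω = z} with hE
  have hEσ : ∀ z, MeasurableSet[sigmaUpTo X n] (E z) := fun z =>
    MeasurableSet.inter (measurableSet_noRuin_sigmaUpTo X A B n)
      (measurable_walk_sigmaUpTo X le_rfl (measurableSet_singleton (z : ℝ)))
  have hEm : ∀ z, MeasurableSet (E z) := fun z => sigmaUpTo_le hX.1 n _ (hEσ z)
  have hU : noRuin X A B n = ⋃ z ∈ Finset.Ioo (-(B : ℤ)) A, E z := by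
    ext ω
    simp only [mem_iUnion, exists_prop]
    constructor
    · intro h
      obtain ⟨z, hz, hw⟩ := exists_int_walk_of_mem_noRuin hX.2.1 hA hB n h
      exact ⟨z, hz, h, hw⟩
    · rintro ⟨z, _, h, _⟩
      exact h
  have hdisj : (↑(Finset.Ioo (-(B : ℤ)) A) : Set ℤ).Pairwise (Function.onFun Disjoint E) := by
    intro z _ z' _ hzz'
    refine Set.disjoint_left.2 fun ω h h' => hzz' ?_
    exact_mod_cast (Eq.symm h.2).trans h'.2
  have hn' : 1 ≤ n + 1 := by omega
  have hint := hX.integrable_potential hR hn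
  have hintc : Integrable (fun ω => R (walk X n ω) (X n ω) + c) μ :=
    hint.add (integrable_const c)
  have hint' := hX.integrable_potential hR hn'
  have hpiece : ∀ z, ∫ ω in E z, R (walk X (n + 1) ω) (X (n + 1) ω) ∂μ =
      ∫ ω in E z, (R (walk X n ω) (X n ω) + c) ∂μ := by
    intro z
    have h1 : ∫ ω in E z, R (walk X (n + 1) ω) (X (n + 1) ω) ∂μ =
        ∫ ω in E z, R (z + X (n + 1) ω) (X (n + 1) ω) ∂μ :=
      setIntegral_congr_fun (hEm z) fun ω h => by
        have hz : walk X n ω = z := h.2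
        simp only [walk_succ, hz]
    rw [h1, hX.setIntegral_succ hk hn (hEσ z) (fun j => R (z + j) j)]
    refine setIntegral_congr_fun (hEm z) fun ω h => ?_
    have hz : walk X n ω = z := h.2
    simp only [hstep z _ (hX.mem_finset hn ω), hz]
  have hsum : ∫ ω in noRuin X A B n, R (walk X (n + 1) ω) (X (n + 1) ω) ∂μ =
      ∫ ω in noRuin X A B n, (R (walk X n ω) (X n ω) + c) ∂μ := by
    rw [hU, integral_biUnion_finset _ (fun z _ => hEm z) hdisj fun z _ => hint'.integrableOn,
      integral_biUnion_finset _ (fun z _ => hEm z) hdisj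
        fun z _ => hintc.integrableOn]
    exact Finset.sum_congr rfl fun z _ => hpiece z
  rw [hsum, integral_add hint.integrableOn (integrable_const c), setIntegral_const, smul_eq_mul,
    mul_comm c]

omit [IsProbabilityMeasure μ] in
/-- A potential vanishing at ruin may be integrated over the smaller event of no ruin up to
time `n + 1`. -/
lemma IsDelayedCRW.setIntegral_noRuin_succ (hX : IsDelayedCRW μ X p q r)
    (hA : 0 < A) (hB : 0 < B) (hRA : R A 1 = 0) (hRB : R (-B) (-1) = 0) (n : ℕ) :
    ∫ ω in noRuin X A B (n + 1), R (walk X (n + 1) ω) (X (n + 1) ω) ∂μ =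
      ∫ ω in noRuin X A B n, R (walk X (n + 1) ω) (X (n + 1) ω) ∂μ := by
  symm
  refine setIntegral_eq_of_subset_of_forall_sdiff_eq_zero (hX.measurableSet_noRuin A B n)
    (fun ω h => (mem_noRuin_succ.1 h).1) fun ω h => ?_
  rcases walk_step_of_ruin hX.2.1 hA hB n h.1 h.2 with ⟨h1, h2⟩ | ⟨h1, h2⟩
  · rw [h1, h2, hRA]
  · rw [h1, h2, hRB]

/-- The probabilities of no ruin sum to the value determined by any potential that vanishes at
ruin and increases by `c` on average at each step. -/
lemma IsDelayedCRW.hasSum_noRuin (hX : IsDelayedCRW μ X p q r)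
    (hk : ∀ i j, 0 ≤ delayKernel p q r i j) (hA : 0 < A) (hB : 0 < B)
    (hR : Continuous fun x : ℝ × ℝ => R x.1 x.2) (hc : 0 < c)
    (hRA : R A 1 = 0) (hRB : R (-B) (-1) = 0)
    (hstep : ∀ s, ∀ i ∈ ({1, 0, -1} : Finset ℝ),
      delayAverage p q r (fun j => R (s + j) j) i = R s i + c) :
    HasSum (fun n => μ.real (noRuin X A B n)) (1 - (∫ ω, R (X 1 ω) (X 1 ω) ∂μ) / c) := by
  set w : ℕ → ℝ := fun n =>
    ∫ ω in noRuin X A B (n + 1), R (walk X (n + 1) ω) (X (n + 1) ω) ∂μ with hw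
  have hw0 : w 0 = ∫ ω, R (X 1 ω) (X 1 ω) ∂μ := by
    simp only [hw, hX.setIntegral_noRuin_succ hA hB hRA hRB 0, noRuin_zero, zero_add,
      walk_one, setIntegral_univ]
  have hwsucc : ∀ n, w (n + 1) = w n + c * μ.real (noRuin X A B (n + 1)) := fun n => by
    simp only [hw]
    rw [hX.setIntegral_noRuin_succ hA hB hRA hRB (n + 1),
      hX.setIntegral_potential_step hk hA hB hR hstep (Nat.le_add_left 1 n)]
  have hwsum : ∀ n, c * ∑ k ∈ Finset.range n, μ.real (noRuin X A B (k + 1)) = w n - w 0 := by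
    intro n
    induction n with
    | zero => simp
    | succ n ih => rw [Finset.sum_range_succ, mul_add, ih, hwsucc]; ring
  obtain ⟨K, hK⟩ := exists_abs_le_of_continuous hR (A + B)
  have hwK : ∀ n, |w n| ≤ K * μ.real (noRuin X A B (n + 1)) := by
    intro n
    rw [← Real.norm_eq_abs]
    refine norm_setIntegral_le_of_norm_le_const (measure_lt_top μ _) fun ω h => ?_
    refine hK _ _ ?_ (hX.abs_step_le (Nat.le_add_left 1 n) ω)
    obtain ⟨z, hz, hwz⟩ := exists_int_walk_of_mem_noRuin hX.2.1 hA hB _ h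
    rw [hwz]
    have hz' : |z| ≤ (A : ℤ) + B := by
      simp only [Finset.mem_Ioo] at hz
      rw [abs_le]
      omega
    exact_mod_cast hz'
  have hK0 : 0 ≤ K := (abs_nonneg _).trans (hK 0 0 (by simp; positivity) (by simp))
  have hsummable : Summable fun n => μ.real (noRuin X A B (n + 1)) := by
    refine summable_of_sum_range_le (c := (K - w 0) / c) (fun n => measureReal_nonneg) fun n => ?_
    rw [le_div_iff₀' hc, hwsum]
    have h1 := (le_abs_self _).trans (hwK n)
    have h2 : K * μ.real (noRuin X A B (n + 1)) ≤ K * 1 :=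
      mul_le_mul_of_nonneg_left measureReal_le_one hK0
    linarith
  have hwlim : Filter.Tendsto w Filter.atTop (nhds 0) := by
    refine squeeze_zero_norm hwK ?_
    simpa using hsummable.tendsto_atTop_zero.const_mul K
  have hsum : HasSum (fun n => μ.real (noRuin X A B (n + 1))) ((0 - w 0) / c) := by
    rw [hsummable.hasSum_iff_tendsto_nat]
    have h := (hwlim.sub_const (w 0)).div_const c
    refine h.congr fun n => ?_
    rw [← hwsum, mul_div_cancel_left₀ _ hc.ne']
  rw [← hasSum_nat_add_iff' 1]
  have h0 : 1 - w 0 / c - ∑ i ∈ Finset.range 1, μ.real (noRuin X A B i) = (0 - w 0) / c := by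
    rw [Finset.sum_range_one, noRuin_zero, probReal_univ]
    ring
  rw [← hw0, h0]
  exact hsum

end Potential

omit [MeasurableSpace Ω] in
/-- The ruin time counts the times at which ruin has not yet occurred. -/
lemma ruinTime_eq_tsum {X : ℕ → Ω → ℝ} {A B : ℕ} (hA : 0 < A) (hB : 0 < B) {ω : Ω}
    (h : ∃ n, ω ∉ noRuin X A B n) :
    ((sInf {k | walk X k ω = (A : ℝ) ∨ walk X k ω = -(B : ℝ)} : ℕ) : ℝ) =
      ∑' n, (noRuin X A B n).indicator (fun _ => (1 : ℝ)) ω := by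
  set H : Set ℕ := {k | walk X k ω = (A : ℝ) ∨ walk X k ω = -(B : ℝ)} with hH
  have hne : H.Nonempty := by
    obtain ⟨n, hn⟩ := h
    simp only [noRuin, mem_ofPred_eq, not_forall] at hn
    obtain ⟨k, _, hk⟩ := hn
    exact ⟨k, by simp only [hH, mem_ofPred_eq]; tauto⟩
  have h0 : 0 ∉ H := by
    have hA' : (0 : ℝ) ≠ A := by exact_mod_cast hA.ne
    simp [hH, walk, hA', hB.ne']
  have hmem : ∀ n, ω ∈ noRuin X A B n ↔ n < sInf H := by
    intro n
    constructor
    · intro hn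
      by_contra! hle
      have hs := Nat.sInf_mem hne
      have hpos : 1 ≤ sInf H := Nat.one_le_iff_ne_zero.2 fun e => h0 (e ▸ hs)
      have := hn _ (Finset.mem_Icc.2 ⟨hpos, hle⟩)
      simp only [hH, mem_ofPred_eq] at hs
      tauto
    · intro hn k hk
      have hk' := Nat.notMem_of_lt_sInf ((Finset.mem_Icc.1 hk).2.trans_lt hn)
      simp only [hH, mem_ofPred_eq, not_or] at hk'
      exact hk'
  rw [tsum_eq_sum (s := Finset.range (sInf H)) fun n hn => indicator_of_notMem
      (fun hn' => hn (Finset.mem_range.2 ((hmem n).1 hn'))) _,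
    Finset.sum_congr rfl fun n hn => indicator_of_mem ((hmem n).2 (Finset.mem_range.1 hn)) _]
  simp

/-- The expected ruin time is the sum of the probabilities of no ruin. -/
lemma integral_ruinTime {μ : Measure Ω} [IsProbabilityMeasure μ] {X : ℕ → Ω → ℝ} {A B : ℕ}
    (hA : 0 < A) (hB : 0 < B) (hm : ∀ n, MeasurableSet (noRuin X A B n))
    {m : ℝ} (hsum : HasSum (fun n => μ.real (noRuin X A B n)) m) :
    ∫ ω, ((sInf {k | walk X k ω = (A : ℝ) ∨ walk X k ω = -(B : ℝ)} : ℕ) : ℝ) ∂μ = m := by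
  have hnull : μ (⋂ n, noRuin X A B n) = 0 := by
    rw [← measureReal_eq_zero_iff]
    refine le_antisymm (ge_of_tendsto' hsum.summable.tendsto_atTop_zero fun n => ?_)
      measureReal_nonneg
    exact measureReal_mono (iInter_subset _ n)
  have hae : ∀ᵐ ω ∂μ, ((sInf {k | walk X k ω = (A : ℝ) ∨ walk X k ω = -(B : ℝ)} : ℕ) : ℝ) =
      ∑' n, (noRuin X A B n).indicator (fun _ => (1 : ℝ)) ω := by
    filter_upwards [measure_eq_zero_iff_ae_notMem.1 hnull] with ω hω
    exact ruinTime_eq_tsum hA hB (by simpa using hω)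
  have hint : ∀ n, ∫ ω, (noRuin X A B n).indicator (fun _ => (1 : ℝ)) ω ∂μ =
      μ.real (noRuin X A B n) := fun n => integral_indicator_one (hm n)
  have hnorm : ∀ n ω, ‖(noRuin X A B n).indicator (fun _ => (1 : ℝ)) ω‖ =
      (noRuin X A B n).indicator (fun _ => (1 : ℝ)) ω := fun n ω =>
    Real.norm_of_nonneg (indicator_nonneg (fun _ _ => zero_le_one) ω)
  have h := hasSum_integral_of_summable_integral_norm (μ := μ)
    (F := fun n => (noRuin X A B n).indicator fun _ => (1 : ℝ))
    (fun n => (integrable_const _).indicator (hm n)) (by simpa only [hnorm, hint] using hsum.summable)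
  simp only [hint] at h
  rw [integral_congr_ae hae]
  exact h.unique hsum

/-- The quadratic potential `s² + 2dsx + bx² - (A - B)(s + dx)`, normalised to vanish when the
walk is ruined at `A` or `-B`. -/
def ruinPotential (A B d b s x : ℝ) : ℝ :=
  s ^ 2 + 2 * d * s * x + b * x ^ 2 - (A - B) * (s + d * x) - (A * B + d * (A + B) + b)

lemma delayAverage_ruinPotential {p q r d b c : ℝ} (A B : ℝ)
    (hd : (1 + d) * (2 * p + r - 1) = d)
    (hc : (1 - q) * (1 + 2 * d + b) = c) (hb : (1 - r) * (1 + 2 * d + b) = b + c)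
    (s i : ℝ) (hi : i ∈ ({1, 0, -1} : Finset ℝ)) :
    delayAverage p q r (fun j => ruinPotential A B d b (s + j) j) i =
      ruinPotential A B d b s i + c := by
  simp only [Finset.mem_insert, Finset.mem_singleton] at hi
  have h10 : (-1 : ℝ) ≠ 0 := by norm_num
  have h10' : (1 : ℝ) ≠ 0 := one_ne_zero
  have h11 : (-1 : ℝ) ≠ 1 := by norm_num
  have h01 : (0 : ℝ) ≠ 1 := by norm_num
  have hsum : ∀ g : ℝ → ℝ, ∑ j ∈ ({1, 0, -1} : Finset ℝ), g j = g 1 + g 0 + g (-1) := by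
    intro g
    rw [Finset.sum_insert (by norm_num), Finset.sum_insert (by norm_num), Finset.sum_singleton]
    ring
  rcases hi with rfl | rfl | rfl
  · simp only [delayAverage, hsum, delayKernel, ruinPotential, h10, h10', h11, h01, if_true, if_false]
    linear_combination (2 * s - (A - B)) * hd + hb
  · simp only [delayAverage, hsum, delayKernel, ruinPotential, h10, h10', h01, if_true, if_false]
    linear_combination hc
  · simp only [delayAverage, hsum, delayKernel, ruinPotential, h10, h10', h11, h01, if_true, if_false]
    linear_combination (-(2 * s - (A - B))) * hd + hb

/-- The mean of the quadratic potential after the first step. -/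
lemma IsDelayedCRW.integral_ruinPotential_one {μ : Measure Ω} [IsProbabilityMeasure μ]
    {X : ℕ → Ω → ℝ} {p q r : ℝ} (hq1 : q < 1) (hr0 : 0 ≤ r) (hX : IsDelayedCRW μ X p q r)
    (A B d b : ℝ) :
    ∫ ω, ruinPotential A B d b (X 1 ω) (X 1 ω) ∂μ =
      (1 + 2 * d + b) * ((1 - q) / (1 + r - q)) - (A * B + d * (A + B) + b) := by
  have hpos : 0 < 1 + r - q := by linarith
  have hsum : ∀ f : ℝ → ℝ, ∫ ω, f (X 1 ω) ∂μ =
      μ.real {ω | X 1 ω = 1} * f 1 + μ.real {ω | X 1 ω = 0} * f 0 +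
        μ.real {ω | X 1 ω = -1} * f (-1) := by
    intro f
    rw [← setIntegral_univ, setIntegral_comp_eq_sum (hX.1 1 le_rfl) (hX.mem_finset le_rfl)
      univ f, Finset.sum_insert (by norm_num), Finset.sum_insert (by norm_num),
      Finset.sum_singleton]
    simp only [univ_inter]
    ring
  have h1 : μ.real {ω | X 1 ω = 1} = (1 - q) / (2 * (1 + r - q)) := by
    rw [measureReal_def, hX.2.2.1,
      ENNReal.toReal_ofReal (div_nonneg (by linarith) (by linarith))]
  have h0 : μ.real {ω | X 1 ω = 0} = r / (1 + r - q) := by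
    rw [measureReal_def, hX.2.2.2.1, ENNReal.toReal_ofReal (div_nonneg hr0 hpos.le)]
  have h2 : μ.real {ω | X 1 ω = -1} = (1 - q) / (2 * (1 + r - q)) := by
    have h := hsum fun _ => 1
    simp only [integral_const, probReal_univ, smul_eq_mul, mul_one, h1, h0] at h
    have e : (1 : ℝ) - (1 - q) / (2 * (1 + r - q)) - r / (1 + r - q) =
        (1 - q) / (2 * (1 + r - q)) := by
      field_simp
      ring
    linarith
  rw [hsum fun x => ruinPotential A B d b x x, h1, h0, h2]
  simp only [ruinPotential]
  field_simp
  ring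

/-- Expected waiting time until ruin for the symmetric CRW with delays (with
`2p + r > 0`), started from the stationary distribution: with
`τ = inf{k : S_k = A or S_k = -B}`,
`E(τ) = A·B·(1+r-q)(2-2p-r)/((1-q)(2p+r)) + (A+B)·(2p+r-1)(1+r-q)/((1-q)(2p+r))
        + (q-r)·r/((1-q)(1+r-q))`. -/
theorem delayed_crw_expected_ruin_time
    (μ : Measure Ω) [IsProbabilityMeasure μ] (X : ℕ → Ω → ℝ) (p q r : ℝ)
    (hp0 : 0 ≤ p) (hp1 : p < 1) (hq0 : 0 ≤ q) (hq1 : q < 1)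
    (hr0 : 0 ≤ r) (hr1 : r < 1) (hpr : p + r ≤ 1) (hpos : 0 < 2 * p + r)
    (hX : IsDelayedCRW μ X p q r)
    (A B : ℕ) (hA : 0 < A) (hB : 0 < B)
    (S : ℕ → Ω → ℝ) (hS : ∀ n ω, S n ω = ∑ i ∈ Finset.Icc 1 n, X i ω)
    (τ : Ω → ℕ)
    (hτ : ∀ ω, τ ω = sInf {k | S k ω = (A : ℝ) ∨ S k ω = -(B : ℝ)}) :
    ∫ ω, (τ ω : ℝ) ∂μ
      = (A : ℝ) * (B : ℝ) * ((1 + r - q) * (2 - 2 * p - r) / ((1 - q) * (2 * p + r)))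
        + ((A : ℝ) + (B : ℝ)) * ((2 * p + r - 1) * (1 + r - q) / ((1 - q) * (2 * p + r)))
        + (q - r) * r / ((1 - q) * (1 + r - q)) := by
  obtain rfl : S = walk X := by
    funext n ω
    exact hS n ω
  simp only [hτ]
  have h1 : 0 < 2 - 2 * p - r := by linarith
  have h1' : 2 * (1 - p) - r ≠ 0 := by linarith
  have h2 : 0 < 1 + r - q := by linarith
  have h3 : 0 < 1 - q := by linarith
  set d : ℝ := (2 * p + r - 1) / (2 - 2 * p - r) with hd
  set b : ℝ := (q - r) * (2 * p + r) / ((2 - 2 * p - r) * (1 + r - q)) with hb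
  set c : ℝ := (1 - q) * (2 * p + r) / ((2 - 2 * p - r) * (1 + r - q)) with hc
  have hc0 : 0 < c := by positivity
  have hdb : 1 + 2 * d + b = (2 * p + r) / ((2 - 2 * p - r) * (1 + r - q)) := by
    rw [hd, hb]
    field_simp
    ring
  have hstep : ∀ s, ∀ i ∈ ({1, 0, -1} : Finset ℝ),
      delayAverage p q r (fun j => ruinPotential A B d b (s + j) j) i =
        ruinPotential A B d b s i + c := by
    refine delayAverage_ruinPotential A B ?_ ?_ ?_
    · rw [hd]
      field_simp
      ring
    · rw [hdb, hc]
      ring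
    · rw [hdb, hb, hc]
      field_simp
      ring
  have hsum := hX.hasSum_noRuin (delayKernel_nonneg hp0 hq0 hq1 hr0 hpr) hA hB
    (R := ruinPotential A B d b) (by unfold ruinPotential; fun_prop) hc0
    (by unfold ruinPotential; ring) (by unfold ruinPotential; ring) hstep
  rw [integral_ruinTime hA hB (hX.measurableSet_noRuin A B) hsum,
    hX.integral_ruinPotential_one hq1 hr0, hdb, hd, hb, hc]
  field_simp
  ring
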